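/- For a substitution σ on alphabet A: (i) if there are no bounded letters, X_σ has at most |A| minimal components; (ii) if there is exactly one bounded letter, X_σ has at most |A|−1 minimal components; (iii) if there are at least two bounded letters, X_σ has at most 2|A|−4 minimal components. -/

import Mathlib

open List
open scoped Classical

namespace SubstPaper

variable {A : Type*}

/-- Apply a substitution letterwise to a word. -/
def applyW (σ : A → List A) (u : List A) : List A := u.flatMap σ

/-- `n`-th iterate of a substitution on a word. -/
def iterW (σ : A → List A) (n : ℕ) (u : List A) : List A := (applyW σ)^[n] u

/-- Non-erasing substitution. -/
def NonErasing (σ : A → List A) : Prop := ∀ a, σ a ≠ []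

/-- A letter is bounded if the lengths of its iterated images stay bounded. -/
def IsBounded (σ : A → List A) (a : A) : Prop := ∃ K, ∀ n, (iterW σ n [a]).length ≤ K

/-- A letter is growing if it is not bounded. -/
def IsGrowing (σ : A → List A) (a : A) : Prop := ¬ IsBounded σ a

/-- The prefix of `u` consisting of bounded letters, before the first growing letter. -/
noncomputable def LBw (σ : A → List A) (u : List A) : List A :=
  u.takeWhile (fun a => decide (IsBounded σ a))

/-- The first growing letter of `u` (junk value if none). -/
noncomputable def LCw [Inhabited A] (σ : A → List A) (u : List A) : A :=
  (u.dropWhile (fun a => decide (IsBounded σ a))).headI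

/-- The bounded suffix of `u`, after the last growing letter. -/
noncomputable def RBw (σ : A → List A) (u : List A) : List A :=
  (LBw σ u.reverse).reverse

/-- The last growing letter of `u` (junk value if none). -/
noncomputable def RCw [Inhabited A] (σ : A → List A) (u : List A) : A :=
  LCw σ u.reverse

/-- Growing letters occurring in a word. -/
def alphC (σ : A → List A) (u : List A) : Set A := {c | IsGrowing σ c ∧ c ∈ u}

/-- The map on alphabets induced by the substitution: `D ↦ ⋃_{a ∈ D} alph_C(σ(a))`. -/
def FAlph (σ : A → List A) (D : Set A) : Set A := ⋃ a ∈ D, alphC σ (σ a)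

/-- `D` is a `k`-periodic alphabet: nonempty set of growing letters, `k` least positive
with `F^[k] D = D`. -/
def IsKPeriodicAlph (σ : A → List A) (D : Set A) (k : ℕ) : Prop :=
  D.Nonempty ∧ (∀ a ∈ D, IsGrowing σ a) ∧ 0 < k ∧ (FAlph σ)^[k] D = D ∧
    ∀ j, 0 < j → (FAlph σ)^[j] D = D → k ≤ j

/-- `D` is a minimal alphabet: periodic with no proper nonempty periodic subalphabet. -/
def IsMinimalAlph (σ : A → List A) (D : Set A) : Prop :=
  (∃ k, IsKPeriodicAlph σ D k) ∧
    ∀ D' ⊆ D, D'.Nonempty → (∃ k', IsKPeriodicAlph σ D' k') → D' = D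

/-- The finite word `u` occurs in the bi-infinite word `x`. -/
def OccursIn (x : ℤ → A) (u : List A) : Prop :=
  ∃ i : ℤ, ∀ j : Fin u.length, x (i + j.1) = u.get j

/-- The substitution subshift `X_σ`. -/
def Xsub (σ : A → List A) : Set (ℤ → A) :=
  {x | ∀ u, OccursIn x u → ∃ a n, u <:+: iterW σ n [a]}

/-- The left shift on bi-infinite words. -/
def shiftT (x : ℤ → A) : ℤ → A := fun i => x (i + 1)

/-- A subshift: nonempty, closed, shift-invariant. -/
def IsSubshift [TopologicalSpace A] (X : Set (ℤ → A)) : Prop :=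
  X.Nonempty ∧ IsClosed X ∧ shiftT '' X = X

/-- A minimal subshift: contains no proper subshift. -/
def IsMinimalSubshift [TopologicalSpace A] (X : Set (ℤ → A)) : Prop :=
  IsSubshift X ∧ ∀ Y ⊆ X, IsSubshift Y → Y = X

/-- The periodic bi-infinite word `ωuω`. -/
noncomputable def perWord [Inhabited A] (u : List A) : ℤ → A :=
  fun i => u.getD ((i % (u.length : ℤ)).toNat) default

/-- The shift-orbit closure `X(x)` of a bi-infinite word. -/
def orbitClosure [TopologicalSpace A] (x : ℤ → A) : Set (ℤ → A) :=
  closure {y | ∃ k : ℤ, ∀ i, y i = x (i + k)}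

/-- `x` is the letterwise image of `y` under `σ`, with the origin at the image of
position `0`. -/
def IsSubstImage (σ : A → List A) (y x : ℤ → A) : Prop :=
  ∃ c : ℤ → ℤ, c 0 = 0 ∧ (∀ i, c (i + 1) = c i + (σ (y i)).length) ∧
    ∀ i : ℤ, ∀ j : Fin (σ (y i)).length, x (c i + j.1) = (σ (y i)).get j

/-- The induced map `σ̃` on subshifts: all shifts of images of elements of `X`. -/
def tildeS (σ : A → List A) (X : Set (ℤ → A)) : Set (ℤ → A) :=
  {z | ∃ x ∈ X, ∃ k : ℤ, IsSubstImage σ x (fun i => z (i + k))}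

/-- Growing letters occurring in some element of `X`. -/
def alphCX (σ : A → List A) (X : Set (ℤ → A)) : Set A :=
  {c | IsGrowing σ c ∧ ∃ x ∈ X, ∃ i : ℤ, x i = c}

/-- The subshift of the restriction `σᵏ|_E` (words whose factors occur in some
`σ^{kn}(a)`, `a ∈ E`). -/
def Xrestr (σ : A → List A) (E : Set A) (k : ℕ) : Set (ℤ → A) :=
  {x | ∀ u, OccursIn x u → ∃ a ∈ E, ∃ n, u <:+: iterW σ (k * n) [a]}

/-- A growing letter `c` is left-isolated: `σⁿ(c) = u c v` with `u` nonempty bounded. -/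
def LeftIsolated (σ : A → List A) (c : A) : Prop :=
  IsGrowing σ c ∧ ∃ n, 1 ≤ n ∧ ∃ u v : List A, u ≠ [] ∧ (∀ b ∈ u, IsBounded σ b) ∧
    iterW σ n [c] = u ++ c :: v

/-- A growing letter `c` is right-isolated: `σⁿ(c) = v c u` with `u` nonempty bounded. -/
def RightIsolated (σ : A → List A) (c : A) : Prop :=
  IsGrowing σ c ∧ ∃ n, 1 ≤ n ∧ ∃ u v : List A, u ≠ [] ∧ (∀ b ∈ u, IsBounded σ b) ∧
    iterW σ n [c] = v ++ c :: u

/-- Growing letter that is neither left- nor right-isolated (member of `C_niso`). -/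
def NonIsolated (σ : A → List A) (c : A) : Prop :=
  IsGrowing σ c ∧ ¬ LeftIsolated σ c ∧ ¬ RightIsolated σ c

/-- A periodic letter: bounded, and occurring in some `σⁿ(a)`, `n ≥ 1`. -/
def IsPeriodicLetter (σ : A → List A) (a : A) : Prop :=
  IsBounded σ a ∧ ∃ n, 1 ≤ n ∧ [a] <:+: iterW σ n [a]

/-- `(a,u,b)` is a 1-block of the word `w`. -/
def Is1Block (σ : A → List A) (w : List A) (t : A × List A × A) : Prop :=
  IsGrowing σ t.1 ∧ IsGrowing σ t.2.2 ∧ (∀ x ∈ t.2.1, IsBounded σ x) ∧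
    (t.1 :: (t.2.1 ++ [t.2.2])) <:+: w

/-- The descendant map on 1-blocks. -/
noncomputable def Desc [Inhabited A] (σ : A → List A) : A × List A × A → A × List A × A :=
  fun t => (RCw σ (σ t.1), RBw σ (σ t.1) ++ applyW σ t.2.1 ++ LBw σ (σ t.2.2), LCw σ (σ t.2.2))

/-- The bi-infinite word `ωu.wvω`. -/
noncomputable def biWord [Inhabited A] (u w v : List A) : ℤ → A := fun i =>
  if i < 0 then u.getD ((i % (u.length : ℤ)).toNat) default
  else if i < (w.length : ℤ) then w.getD i.toNat default
  else v.getD (((i - (w.length : ℤ)) % (v.length : ℤ)).toNat) default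

section Words

lemma applyW_append (σ : A → List A) (u v : List A) :
    applyW σ (u ++ v) = applyW σ u ++ applyW σ v := by
  simp [applyW]

lemma applyW_cons (σ : A → List A) (a : A) (u : List A) :
    applyW σ (a :: u) = σ a ++ applyW σ u := by
  simp [applyW]

lemma iterW_zero (σ : A → List A) (u : List A) : iterW σ 0 u = u := rfl

lemma iterW_succ (σ : A → List A) (n : ℕ) (u : List A) :
    iterW σ (n + 1) u = iterW σ n (applyW σ u) := rfl

lemma iterW_succ' (σ : A → List A) (n : ℕ) (u : List A) :
    iterW σ (n + 1) u = applyW σ (iterW σ n u) :=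
  Function.iterate_succ_apply' _ _ _

lemma iterW_add (σ : A → List A) (m n : ℕ) (u : List A) :
    iterW σ (m + n) u = iterW σ m (iterW σ n u) :=
  Function.iterate_add_apply _ _ _ _

lemma iterW_append (σ : A → List A) (n : ℕ) (u v : List A) :
    iterW σ n (u ++ v) = iterW σ n u ++ iterW σ n v := by
  induction n generalizing u v with
  | zero => rfl
  | succ n ih => simp [iterW_succ, applyW_append, ih]

lemma iterW_nil (σ : A → List A) (n : ℕ) : iterW σ n [] = [] := by
  induction n with
  | zero => rfl
  | succ n ih => simpa [iterW_succ, applyW] using ih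

lemma iterW_eq_flatMap (σ : A → List A) (n : ℕ) (u : List A) :
    iterW σ n u = u.flatMap (fun a => iterW σ n [a]) := by
  induction u with
  | nil => simp [iterW_nil]
  | cons a u ih =>
    rw [← List.singleton_append, iterW_append, ih]
    simp

lemma iterW_infix (σ : A → List A) (n : ℕ) {u v : List A} (h : u <:+: v) :
    iterW σ n u <:+: iterW σ n v := by
  obtain ⟨s, t, rfl⟩ := h
  exact ⟨iterW σ n s, iterW σ n t, by simp [iterW_append]⟩

lemma mem_iterW (σ : A → List A) (n : ℕ) {u : List A} {x : A} :
    x ∈ iterW σ n u ↔ ∃ a ∈ u, x ∈ iterW σ n [a] := by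
  rw [iterW_eq_flatMap, List.mem_flatMap]

lemma iterW_singleton_infix (σ : A → List A) (n : ℕ) {u : List A} {x : A} (h : x ∈ u) :
    iterW σ n [x] <:+: iterW σ n u :=
  iterW_infix σ n ((List.singleton_infix_iff x u).2 h)

lemma length_flatMap_le {f : A → List A} {M : ℕ} {u : List A}
    (h : ∀ a ∈ u, (f a).length ≤ M) : (u.flatMap f).length ≤ u.length * M := by
  induction u with
  | nil => simp
  | cons a u ih =>
    have h1 := h a (by simp)
    have h2 := ih (fun b hb => h b (by simp [hb]))
    simp only [List.flatMap_cons, List.length_append, List.length_cons]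
    nlinarith

lemma length_le_applyW {σ : A → List A} (hσ : NonErasing σ) (u : List A) :
    u.length ≤ (applyW σ u).length := by
  induction u with
  | nil => simp
  | cons a u ih =>
    have := List.length_pos_iff.2 (hσ a)
    simp only [applyW_cons, List.length_append, List.length_cons]
    omega

lemma length_iterW_mono {σ : A → List A} (hσ : NonErasing σ) {m n : ℕ} (h : m ≤ n)
    (u : List A) : (iterW σ m u).length ≤ (iterW σ n u).length := by
  induction n, h using Nat.le_induction with
  | base => exact le_rfl
  | succ n _ ih =>
    rw [iterW_succ']
    exact ih.trans (length_le_applyW hσ _)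

/-- The substitution `σ^q`. -/
def powS (σ : A → List A) (q : ℕ) : A → List A := fun a => iterW σ q [a]

/-- The mirror substitution. -/
def revS (σ : A → List A) : A → List A := fun a => (σ a).reverse

lemma applyW_powS (σ : A → List A) (q : ℕ) (u : List A) :
    applyW (powS σ q) u = iterW σ q u := (iterW_eq_flatMap σ q u).symm

lemma iterW_powS (σ : A → List A) (q n : ℕ) (u : List A) :
    iterW (powS σ q) n u = iterW σ (q * n) u := by
  induction n generalizing u with
  | zero => rfl
  | succ n ih => rw [iterW_succ, ih, applyW_powS, ← iterW_add, Nat.mul_succ]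

lemma applyW_revS (σ : A → List A) (u : List A) :
    applyW (revS σ) u.reverse = (applyW σ u).reverse := by
  rw [applyW, applyW, List.reverse_flatMap]
  rfl

lemma iterW_revS (σ : A → List A) (n : ℕ) (u : List A) :
    iterW (revS σ) n u.reverse = (iterW σ n u).reverse := by
  induction n generalizing u with
  | zero => rfl
  | succ n ih => rw [iterW_succ, applyW_revS, ih, ← iterW_succ]

lemma powS_revS (σ : A → List A) (q : ℕ) : powS (revS σ) q = revS (powS σ q) := by
  funext a
  simpa [powS, revS] using iterW_revS σ q [a]

lemma isBounded_revS (σ : A → List A) : IsBounded (revS σ) = IsBounded σ := by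
  funext a
  have h : ∀ n, (iterW (revS σ) n [a]).length = (iterW σ n [a]).length := fun n => by
    simpa using congrArg List.length (iterW_revS σ n [a])
  simp [IsBounded, h]

lemma prefix_flatMap {f : A → List A} {z s : List A} (h : z <+: s.flatMap f) (hz : z ≠ []) :
    ∃ t b y, t ++ [b] <+: s ∧ z = t.flatMap f ++ y ∧ y <+: f b := by
  induction s generalizing z with
  | nil => simp_all
  | cons a s ih =>
    obtain ⟨r, hr⟩ := h
    rw [List.flatMap_cons, List.append_eq_append_iff] at hr
    rcases hr with ⟨as, h1, -⟩ | ⟨bs, h1, h2⟩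
    · exact ⟨[], a, z, by simp, by simp, ⟨as, h1.symm⟩⟩
    · by_cases hb : bs = []
      · exact ⟨[], a, z, by simp, by simp, by simp [h1, hb]⟩
      · obtain ⟨t, b, y, h3, h4, h5⟩ := ih ⟨r, h2.symm⟩ hb
        refine ⟨a :: t, b, y, ?_, by simp [h1, h4], h5⟩
        simpa using h3

lemma infix_flatMap {f : A → List A} {u s : List A} (h : u <:+: s.flatMap f) (hu : u ≠ []) :
    (∃ a ∈ s, u <:+: f a) ∨ ∃ a t b x y, a :: (t ++ [b]) <:+: s ∧
      u = x ++ t.flatMap f ++ y ∧ x <:+ f a ∧ y <+: f b := by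
  induction s with
  | nil => simp_all
  | cons a s ih =>
    rw [List.flatMap_cons, List.infix_append_iff] at h
    rcases h with h | h | ⟨x, z, rfl, hx, hz⟩
    · exact Or.inl ⟨a, by simp, h⟩
    · rcases ih h with ⟨b, hb, h'⟩ | ⟨b, t, c, x, y, h1, h2⟩
      · exact Or.inl ⟨b, by simp [hb], h'⟩
      · exact Or.inr ⟨b, t, c, x, y, h1.trans (List.suffix_cons a s).isInfix, h2⟩
    · by_cases hz0 : z = []
      · exact Or.inl ⟨a, by simp, by simpa [hz0] using hx.isInfix⟩
      · obtain ⟨t, b, y, h3, rfl, h5⟩ := prefix_flatMap hz hz0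
        refine Or.inr ⟨a, t, b, x, y, ?_, by simp, hx, h5⟩
        exact ((List.prefix_cons_inj a).2 h3).isInfix

lemma suffix_of_suffix_append_cons {x v w : List A} {c : A} (h : x <:+ v ++ c :: w)
    (hc : c ∉ x) : x <:+ w := by
  have h1 : c :: w <:+ v ++ c :: w := List.suffix_append _ _
  by_cases hl : x.length ≤ w.length
  · exact List.suffix_of_suffix_length_le h ((List.suffix_cons c w).trans h1) hl
  · have := List.suffix_of_suffix_length_le h1 h (by simp; omega)
    exact absurd (this.subset (by simp)) hc

lemma append_cons_inj_of_forall {B : A → Prop} {v v' w w' : List A} {c c' : A} (hc : ¬ B c)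
    (hc' : ¬ B c') (hw : ∀ x ∈ w, B x) (hw' : ∀ x ∈ w', B x)
    (h : v ++ c :: w = v' ++ c' :: w') : c = c' ∧ w = w' := by
  have h1 : w <:+ w' := suffix_of_suffix_append_cons (v := v') (c := c')
    (h ▸ ((List.suffix_cons c w).trans (List.suffix_append _ _))) (fun hx => hc' (hw _ hx))
  have h2 : w' <:+ w := suffix_of_suffix_append_cons (v := v) (c := c)
    (h ▸ ((List.suffix_cons c' w').trans (List.suffix_append _ _))) (fun hx => hc (hw' _ hx))
  have h3 : w = w' := h1.eq_of_length (le_antisymm h1.length_le h2.length_le)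
  subst h3
  have := (List.append_inj' h rfl).2
  exact ⟨by simpa using this, rfl⟩

end Words

section Idempotent

/-- `c` is the last letter of `u` that is not in `B`. -/
def IsLastOut (B : A → Prop) (u : List A) (c : A) : Prop :=
  ∃ v w, u = v ++ c :: w ∧ ¬ B c ∧ ∀ x ∈ w, B x

lemma IsLastOut.unique {B : A → Prop} {u : List A} {c d : A} (hc : IsLastOut B u c)
    (hd : IsLastOut B u d) : c = d := by
  obtain ⟨v, w, h, h1, h2⟩ := hc
  obtain ⟨v', w', h', h1', h2'⟩ := hd
  exact (append_cons_inj_of_forall h1 h1' h2 h2' (h.symm.trans h')).1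

lemma exists_isLastOut {B : A → Prop} {u : List A} (h : ∃ x ∈ u, ¬ B x) :
    ∃ c, IsLastOut B u c := by
  induction u using List.reverseRecOn with
  | nil => simp at h
  | append_singleton u a ih =>
    by_cases ha : B a
    · obtain ⟨x, hx, hBx⟩ := h
      have hxu : x ∈ u := by
        rcases List.mem_append.1 hx with h | h
        · exact h
        · simp at h; subst h; contradiction
      obtain ⟨c, v, w, rfl, h1, h2⟩ := ih ⟨x, hxu, hBx⟩
      refine ⟨c, v, w ++ [a], by simp, h1, fun y hy => ?_⟩
      rcases List.mem_append.1 hy with h | h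
      · exact h2 y h
      · simp at h; subst h; exact ha
    · exact ⟨a, u, [], rfl, ha, by simp⟩

lemma isLastOut_applyW {σ : A → List A} {B : A → Prop} (hB : ∀ b, B b → ∀ x ∈ σ b, B x)
    (hG : ∀ c, ¬ B c → ∃ x ∈ σ c, ¬ B x) (u : List A) (e : A) :
    IsLastOut B (applyW σ u) e ↔ ∃ d, IsLastOut B u d ∧ IsLastOut B (σ d) e := by
  have key : ∀ d e, IsLastOut B u d → IsLastOut B (σ d) e → IsLastOut B (applyW σ u) e := by
    rintro d e ⟨v, w, rfl, -, hw⟩ ⟨v', w', h, he, hw'⟩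
    refine ⟨applyW σ v ++ v', w' ++ applyW σ w, ?_, he, fun x hx => ?_⟩
    · simp [applyW_append, applyW_cons, h]
    · rcases List.mem_append.1 hx with hx | hx
      · exact hw' x hx
      · obtain ⟨b, hb, hxb⟩ := List.mem_flatMap.1 hx
        exact hB b (hw b hb) x hxb
  constructor
  · intro h
    have hu : ∃ x ∈ u, ¬ B x := by
      by_contra! hcon
      obtain ⟨v, w, h1, h2, -⟩ := h
      have : e ∈ applyW σ u := by simp [h1]
      obtain ⟨b, hb, heb⟩ := List.mem_flatMap.1 this
      exact h2 (hB b (hcon b hb) e heb)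
    obtain ⟨d, hd⟩ := exists_isLastOut hu
    have hd' := hd
    obtain ⟨-, -, -, hdB, -⟩ := hd'
    obtain ⟨e', he'⟩ := exists_isLastOut (hG d hdB)
    obtain rfl := h.unique (key d e' hd he')
    exact ⟨d, hd, he'⟩
  · rintro ⟨d, h1, h2⟩
    exact key d e h1 h2

/-- A non-erasing substitution with bounded letters `B` whose action on bounded letters, on
alphabets and on last growing letters is idempotent. -/
structure Idem (τ : A → List A) (B : A → Prop) : Prop where
  ne : NonErasing τ
  closed : ∀ b, B b → ∀ x ∈ τ b, B x
  grow : ∀ c, ¬ B c → ∃ x ∈ τ c, ¬ B x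
  bdd : ∃ M, ∀ b, B b → ∀ n, (iterW τ n [b]).length ≤ M
  unbdd : ∀ c, ¬ B c → ∀ N, ∃ n, N ≤ (iterW τ n [c]).length
  word : ∀ b, B b → applyW τ (τ b) = τ b
  alph : ∀ c e, ¬ B c → ¬ B e → e ∈ τ c → e ∈ applyW τ (τ c)
  last : ∀ c d, ¬ B c → IsLastOut B (τ c) d → IsLastOut B (τ d) d

lemma isBounded_of_mem_iterW {σ : A → List A} {a x : A} (ha : IsBounded σ a) {m : ℕ}
    (hx : x ∈ iterW σ m [a]) : IsBounded σ x := by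
  obtain ⟨K, hK⟩ := ha
  refine ⟨K, fun n => ?_⟩
  have h := (iterW_singleton_infix σ n hx).length_le
  rw [← iterW_add] at h
  exact h.trans (hK _)

lemma exists_uniform_bound [Finite A] (σ : A → List A) :
    ∃ M, ∀ b, IsBounded σ b → ∀ n, (iterW σ n [b]).length ≤ M := by
  have h : ∀ b, ∃ M, IsBounded σ b → ∀ n, (iterW σ n [b]).length ≤ M := fun b => by
    by_cases hb : IsBounded σ b
    · obtain ⟨K, hK⟩ := hb
      exact ⟨K, fun _ => hK⟩
    · exact ⟨0, fun h => absurd h hb⟩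
  choose M hM using h
  obtain ⟨K, hK⟩ := (Set.finite_range M).bddAbove
  exact ⟨K, fun b hb n => (hM b hb n).trans (hK ⟨b, rfl⟩)⟩

lemma exists_growing_mem_iterW [Finite A] {σ : A → List A} (hσ : NonErasing σ) {c : A}
    (hc : ¬ IsBounded σ c) (q : ℕ) : ∃ x ∈ iterW σ q [c], ¬ IsBounded σ x := by
  by_contra! hcon
  obtain ⟨M, hM⟩ := exists_uniform_bound σ
  refine hc ⟨(iterW σ q [c]).length * M, fun n => ?_⟩
  refine (length_iterW_mono hσ (Nat.le_add_right n q) _).trans ?_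
  rw [iterW_add, iterW_eq_flatMap]
  exact length_flatMap_le fun a ha => hM a (hcon a ha) n

lemma exists_idempotent_iterate {β : Type*} (h : β → β) (x : β)
    (hfin : (Set.range fun n => h^[n] x).Finite) :
    ∃ p, 0 < p ∧ ∀ q, 0 < q → p ∣ q → h^[q + q] x = h^[q] x := by
  have hni : ¬ Function.Injective fun n => h^[n] x := fun hinj =>
    Set.infinite_range_of_injective hinj hfin
  obtain ⟨m, n, hmn, hne⟩ : ∃ m n, m < n ∧ h^[m] x = h^[n] x := by
    simp only [Function.Injective, not_forall] at hni
    obtain ⟨m, n, h1, h2⟩ := hni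
    rcases lt_or_gt_of_ne h2 with h | h
    · exact ⟨m, n, h, h1⟩
    · exact ⟨n, m, h, h1.symm⟩
  have hper : ∀ j k, m ≤ k → h^[k + (n - m) * j] x = h^[k] x := by
    intro j
    induction j with
    | zero => simp
    | succ j ih =>
      intro k hk
      have e1 : k + (n - m) * (j + 1) = (k - m) + n + (n - m) * j := by
        rw [Nat.mul_succ]; omega
      have e2 : k = (k - m) + m := by omega
      rw [e1, ih _ (by omega), Function.iterate_add_apply, ← hne, ← Function.iterate_add_apply,
        ← e2]
  refine ⟨(n - m) * (m + 1), Nat.mul_pos (by omega) (by omega), fun q hq hd => ?_⟩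
  obtain ⟨r, rfl⟩ := hd
  have hm : m ≤ (n - m) * (m + 1) * r := by
    have h1 : 1 ≤ n - m := by omega
    have h2 : 1 ≤ r := Nat.pos_of_ne_zero fun h0 => by simp [h0] at hq
    calc m ≤ 1 * (m + 1) * 1 := by omega
      _ ≤ _ := by gcongr
  conv_lhs => rw [show (n - m) * (m + 1) * r + (n - m) * (m + 1) * r
    = (n - m) * (m + 1) * r + (n - m) * ((m + 1) * r) by ring]
  exact hper _ _ hm

lemma exists_idem_powS [Finite A] {σ : A → List A} (hσ : NonErasing σ) :
    ∃ p, 0 < p ∧ ∀ q, 0 < q → p ∣ q → Idem (powS σ q) (IsBounded σ) := by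
  set B := IsBounded σ with hBdef
  have hB : ∀ q b, B b → ∀ x ∈ powS σ q b, B x := fun q b hb x hx =>
    isBounded_of_mem_iterW hb hx
  have hG : ∀ q c, ¬ B c → ∃ x ∈ powS σ q c, ¬ B x := fun q c hc =>
    exists_growing_mem_iterW hσ hc q
  have hpow1 : powS σ 1 = σ := by
    funext a
    simp [powS, iterW_succ, iterW_zero, applyW]
  have hB1 := hB 1
  have hG1 := hG 1
  rw [hpow1] at hB1 hG1
  obtain ⟨M, hM⟩ := exists_uniform_bound σ
  let h : Set A × Set A × List A → Set A × Set A × List A := fun t =>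
    ({e | ¬ B e ∧ ∃ c ∈ t.1, e ∈ σ c}, {e | ∃ d ∈ t.2.1, IsLastOut B (σ d) e}, applyW σ t.2.2)
  let g : A → ℕ → Set A × Set A × List A := fun a n =>
    ({e | ¬ B e ∧ e ∈ iterW σ n [a]}, {e | IsLastOut B (iterW σ n [a]) e},
      iterW σ n (if B a then [a] else []))
  have hg : ∀ a n, g a n = h^[n] (g a 0) := by
    intro a n
    induction n with
    | zero => rfl
    | succ n ih =>
      rw [Function.iterate_succ_apply', ← ih]
      refine Prod.ext ?_ (Prod.ext ?_ ?_)
      · ext e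
        simp only [g, h, iterW_succ', Set.mem_ofPred_eq]
        refine and_congr_right fun he => ?_
        constructor
        · intro hx
          obtain ⟨b, hb, hxb⟩ := List.mem_flatMap.1 hx
          exact ⟨b, ⟨fun hbB => he (hB1 b hbB e hxb), hb⟩, hxb⟩
        · rintro ⟨b, ⟨-, hb⟩, hxb⟩
          exact List.mem_flatMap.2 ⟨b, hb, hxb⟩
      · ext e
        simp only [g, h, iterW_succ', Set.mem_ofPred_eq]
        exact isLastOut_applyW hB1 hG1 _ _
      · simp only [g, h, iterW_succ']
  have hex : ∀ a, ∃ p, 0 < p ∧ ∀ q, 0 < q → p ∣ q → g a (q + q) = g a q := by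
    intro a
    suffices hfin : (Set.range (g a)).Finite by
      rw [show g a = fun n => h^[n] (g a 0) from funext (hg a)] at hfin
      obtain ⟨p, hp, hp'⟩ := exists_idempotent_iterate h (g a 0) hfin
      exact ⟨p, hp, fun q hq hd => by rw [hg a (q + q), hg a q, hp' q hq hd]⟩
    refine ((Set.finite_univ (α := Set A)).prod ((Set.finite_univ (α := Set A)).prod
      (List.finite_length_le A M))).subset ?_
    rintro _ ⟨n, rfl⟩
    refine ⟨trivial, trivial, ?_⟩
    by_cases ha : B a
    · simpa [g, ha] using hM a ha n
    · simp [g, ha, iterW_nil]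
  choose p hp0 hp using hex
  have := Fintype.ofFinite A
  refine ⟨∏ a, p a, Finset.prod_pos fun a _ => hp0 a, fun q hq hdvd => ?_⟩
  have hgq : ∀ a, g a (q + q) = g a q := fun a =>
    hp a q hq ((Finset.dvd_prod_of_mem p (Finset.mem_univ a)).trans hdvd)
  have happ : ∀ a, applyW (powS σ q) (powS σ q a) = iterW σ (q + q) [a] := fun a => by
    rw [applyW_powS, powS, iterW_add]
  refine ⟨fun a => ?_, hB q, hG q, ⟨M, fun b hb n => ?_⟩, fun c hc N => ?_, fun b hb => ?_,
    fun c e hc he hec => ?_, fun c d hc hd => ?_⟩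
  · have := length_iterW_mono hσ (Nat.zero_le q) [a]
    exact List.length_pos_iff.1 (lt_of_lt_of_le (by simp [iterW_zero]) this)
  · rw [iterW_powS]
    exact hM b hb _
  · by_contra! hcon
    refine hc ⟨N, fun n => ?_⟩
    refine (length_iterW_mono hσ (Nat.le_mul_of_pos_left n hq) [c]).trans ?_
    rw [← iterW_powS]
    exact (hcon n).le
  · have := congrArg (fun t => t.2.2) (hgq b)
    simp only [g, hb, if_true] at this
    rw [happ, this, powS]
  · have := congrArg (fun t => e ∈ t.1) (hgq c)
    simp only [g, Set.mem_ofPred_eq, he, not_false_eq_true, true_and, eq_iff_iff] at this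
    rw [happ, this]
    exact hec
  · have h1 := congrArg (fun t => d ∈ t.2.1) (hgq c)
    simp only [g, Set.mem_ofPred_eq, eq_iff_iff] at h1
    have h2 := h1.2 hd
    rw [← happ, isLastOut_applyW (hB q) (hG q)] at h2
    obtain ⟨d', h3, h4⟩ := h2
    rwa [← h3.unique hd] at h4 ⊢

lemma exists_idem_powS_both [Finite A] {σ : A → List A} (hσ : NonErasing σ) :
    ∃ q, 0 < q ∧ Idem (powS σ q) (IsBounded σ) ∧ Idem (revS (powS σ q)) (IsBounded σ) := by
  obtain ⟨p, hp, h⟩ := exists_idem_powS hσ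
  have hσ' : NonErasing (revS σ) := fun a => by simpa [revS] using hσ a
  obtain ⟨p', hp', h'⟩ := exists_idem_powS hσ'
  have hpos := Nat.mul_pos hp hp'
  refine ⟨p * p', hpos, h _ hpos (Dvd.intro _ rfl), ?_⟩
  have := h' _ hpos (Dvd.intro_left _ rfl)
  rwa [powS_revS, isBounded_revS] at this

end Idempotent

section Language

lemma exists_frequently_of_forall_exists {ι : Type*} [Finite ι] {P : ι → ℕ → Prop}
    (h : ∀ N, ∃ i, P i N) : ∃ i, ∀ N, ∃ n, N ≤ n ∧ P i n := by
  by_contra! hcon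
  choose N hN using hcon
  obtain ⟨M, hM⟩ := (Set.finite_range N).bddAbove
  obtain ⟨i, hi⟩ := h M
  exact hN i M (hM ⟨i, rfl⟩) hi

lemma Idem.mem_iterW_of_bounded {τ : A → List A} {B : A → Prop} (hτ : Idem τ B) (n : ℕ)
    {u : List A} (hu : ∀ x ∈ u, B x) : ∀ x ∈ iterW τ n u, B x := by
  induction n generalizing u with
  | zero => exact hu
  | succ n ih =>
    rw [iterW_succ]
    refine ih fun x hx => ?_
    obtain ⟨b, hb, hxb⟩ := List.mem_flatMap.1 hx
    exact hτ.closed b (hu b hb) x hxb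

lemma Idem.exists_mem_iterW {τ : A → List A} {B : A → Prop} (hτ : Idem τ B) (n : ℕ)
    {c : A} (hc : ¬ B c) : ∃ x ∈ iterW τ n [c], ¬ B x := by
  induction n with
  | zero => exact ⟨c, by simp [iterW_zero], hc⟩
  | succ n ih =>
    obtain ⟨x, hx, hBx⟩ := ih
    obtain ⟨y, hy, hBy⟩ := hτ.grow x hBx
    exact ⟨y, by rw [iterW_succ']; exact List.mem_flatMap.2 ⟨x, hx, hy⟩, hBy⟩

lemma Idem.applyW_of_bounded {τ : A → List A} {B : A → Prop} (hτ : Idem τ B)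
    {u : List A} (hu : ∀ x ∈ u, B x) : applyW τ (applyW τ u) = applyW τ u := by
  induction u with
  | nil => rfl
  | cons a u ih =>
    rw [applyW_cons, applyW_append, hτ.word a (hu a (by simp)),
      ih fun x hx => hu x (by simp [hx])]

/-- Words of length tending to infinity of bounded letters occur in `W`. -/
def HasLongBounded (B : A → Prop) (W : List A → Prop) : Prop :=
  ∀ N, ∃ u, N ≤ u.length ∧ W u ∧ ∀ x ∈ u, B x

/-- All powers of the word `τ(u)`, where `τ(c) = v c u` with `u` nonempty and bounded,
belong to `W`. -/
def RightAtt (τ : A → List A) (B : A → Prop) (c : A) (W : List A → Prop) : Prop :=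
  ¬ B c ∧ ∃ v u, τ c = v ++ c :: u ∧ u ≠ [] ∧ (∀ x ∈ u, B x) ∧
    ∀ m, W (List.replicate m (applyW τ u)).flatten

lemma Idem.iterW_isolated {τ : A → List A} {B : A → Prop} (hτ : Idem τ B) {c : A}
    {v u : List A} (h : τ c = v ++ c :: u) (hu : ∀ x ∈ u, B x) (k : ℕ) :
    ∃ v', iterW τ (k + 1) [c] =
      v' ++ c :: (u ++ (List.replicate k (applyW τ u)).flatten) := by
  induction k with
  | zero => exact ⟨v, by simp [iterW_succ, iterW_zero, applyW, h]⟩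
  | succ k ih =>
    obtain ⟨v', h'⟩ := ih
    have hrep : ∀ k, applyW τ (List.replicate k (applyW τ u)).flatten
        = (List.replicate k (applyW τ u)).flatten := by
      intro k
      induction k with
      | zero => rfl
      | succ k ih =>
        rw [List.replicate_succ, List.flatten_cons, applyW_append, ih, hτ.applyW_of_bounded hu]
    refine ⟨applyW τ v' ++ v, ?_⟩
    rw [iterW_succ', h', applyW_append, applyW_cons, applyW_append, hrep, h,
      List.replicate_succ, List.flatten_cons]
    simp

lemma length_flatten_replicate (k : ℕ) (w : List A) :
    (List.replicate k w).flatten.length = k * w.length := by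
  simp

lemma Idem.exists_rightAtt {τ : A → List A} {B : A → Prop} (hτ : Idem τ B)
    {W : List A → Prop} (hfac : ∀ u v, u <:+: v → W v → W u) {c : A} (hc : ¬ B c)
    (h : ∀ N, ∃ k x, N ≤ x.length ∧ W x ∧ (∀ y ∈ x, B y) ∧ x <:+ iterW τ k [c]) :
    ∃ d, RightAtt τ B d W := by
  obtain ⟨d, hd⟩ := exists_isLastOut (hτ.grow c hc)
  obtain ⟨v', u, hdu, hdB, hu⟩ := hτ.last c d hc hd
  obtain ⟨v, u0, hcd, -, hu0⟩ := hd
  obtain ⟨M, hM⟩ := hτ.bdd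
  set w := applyW τ u with hw
  have key : ∀ m, W (List.replicate m w).flatten ∧ w ≠ [] := by
    intro m
    obtain ⟨k, x, hxN, hWx, hxB, hxs⟩ :=
      h (u.length + m * w.length + u0.length * M + (τ c).length + 2)
    have hdx : d ∉ x := fun h => hdB (hxB d h)
    obtain _ | _ | k := k
    · have := hxs.length_le
      simp [iterW_zero] at this
      omega
    · have := hxs.length_le
      simp [iterW_succ, iterW_zero, applyW] at this
      omega
    obtain ⟨v'', hv''⟩ := hτ.iterW_isolated hdu hu k
    set e := iterW τ (k + 1) u0 with he
    have hel : e.length ≤ u0.length * M := by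
      rw [he, iterW_eq_flatMap]
      exact length_flatMap_le fun a ha => hM a (hu0 a ha) _
    have hform : iterW τ (k + 2) [c] = (iterW τ (k + 1) v ++ v'') ++
        d :: (u ++ (List.replicate k w).flatten ++ e) := by
      have : applyW τ [c] = v ++ ([d] ++ u0) := by simp [applyW, hcd]
      rw [iterW_succ, this, iterW_append, iterW_append, hv'', ← he, ← hw]
      simp
    rw [hform] at hxs
    have hx' := suffix_of_suffix_append_cons hxs hdx
    have hlen := hx'.length_le
    simp only [List.length_append, length_flatten_replicate] at hlen
    have hmk : m * w.length < k * w.length := by omega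
    have hmk' : m < k := lt_of_mul_lt_mul_right hmk (Nat.zero_le _)
    refine ⟨?_, fun h0 => by simp [h0] at hmk⟩
    have hs : (List.replicate m w).flatten ++ e <:+ u ++ (List.replicate k w).flatten ++ e := by
      refine ⟨u ++ (List.replicate (k - m) w).flatten, ?_⟩
      have : k = (k - m) + m := by omega
      conv_rhs => rw [this, List.replicate_add, List.flatten_append]
      simp
    have hs' : (List.replicate m w).flatten ++ e <:+ x :=
      List.suffix_of_suffix_length_le hs hx'
        (by simp only [List.length_append, length_flatten_replicate]; omega)
    exact hfac _ _ ((List.prefix_append _ e).isInfix.trans hs'.isInfix) hWx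
  refine ⟨d, hdB, v', u, hdu, fun h0 => (key 0).2 (by simp [hw, h0, applyW]), hu,
    fun m => (key m).1⟩

lemma iterW_revS_singleton (τ : A → List A) (n : ℕ) (a : A) :
    iterW (revS τ) n [a] = (iterW τ n [a]).reverse := by
  simpa using iterW_revS τ n [a]

lemma exists_length_le [Finite A] (f : A → List A) : ∃ K, ∀ a, (f a).length ≤ K := by
  obtain ⟨K, hK⟩ := (Set.finite_range fun a => (f a).length).bddAbove
  exact ⟨K, fun a => hK ⟨a, rfl⟩⟩

lemma Idem.exists_long_end [Finite A] {τ : A → List A} {B : A → Prop} (hτ : Idem τ B)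
    {W : List A → Prop} (hfac : ∀ u v, u <:+: v → W v → W u) {K : ℕ}
    (hW : ∀ u, W u → ∃ s n, s.length ≤ K ∧ u <:+: iterW τ n s)
    (hlong : HasLongBounded B W) (N : ℕ) :
    ∃ c k x, ¬ B c ∧ N ≤ x.length ∧ W x ∧ (∀ y ∈ x, B y) ∧
      (x <:+ iterW τ k [c] ∨ x <+: iterW τ k [c]) := by
  obtain ⟨M, hM⟩ := hτ.bdd
  obtain ⟨L, hL⟩ := exists_length_le τ
  obtain ⟨u, hul, hWu, huB⟩ := hlong (2 * (N + M + 1) + (K + L) * M + (K + L) + 1)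
  obtain ⟨s, n, hs, hus⟩ := hW u hWu
  replace hs : s.length ≤ K + L := by omega
  induction n generalizing s with
  | zero =>
    have := hus.length_le
    rw [iterW_zero] at this
    omega
  | succ n ih =>
    rw [iterW_eq_flatMap] at hus
    have hu0 : u ≠ [] := by rintro rfl; simp at hul
    rcases infix_flatMap hus hu0 with ⟨a, -, ha⟩ | ⟨a, t, b, x, y, hst, hu, hx, hy⟩
    · refine ih (τ a) ?_ ((hL a).trans (by omega))
      simpa [iterW_succ, applyW] using ha
    · have htB : ∀ e ∈ t, B e := by
        intro e he
        by_contra heB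
        obtain ⟨z, hz, hzB⟩ := hτ.exists_mem_iterW (n + 1) heB
        refine hzB (huB z ?_)
        rw [hu]
        simp only [List.mem_append, List.mem_flatMap]
        exact Or.inl (Or.inr ⟨e, he, hz⟩)
      have htl : (t.flatMap fun a => iterW τ (n + 1) [a]).length ≤ (K + L) * M := by
        refine (length_flatMap_le fun e he => hM e (htB e he) _).trans ?_
        have := hst.length_le
        simp at this
        gcongr
        omega
      have hlen : u.length = x.length + (t.flatMap fun a => iterW τ (n + 1) [a]).length
          + y.length := by rw [hu]; simp; omega
      have hxu : x <:+: u := 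
        ⟨[], (t.flatMap fun a => iterW τ (n + 1) [a]) ++ y, by rw [hu]; simp⟩
      have hyu : y <:+: u := ⟨x ++ t.flatMap fun a => iterW τ (n + 1) [a], [], by rw [hu]; simp⟩
      by_cases hxl : N + M + 1 ≤ x.length
      · refine ⟨a, n + 1, x, fun haB => ?_, by omega, hfac _ _ hxu hWu,
          fun z hz => huB z (hxu.subset hz), Or.inl hx⟩
        have := hx.length_le.trans (hM a haB (n + 1))
        omega
      · refine ⟨b, n + 1, y, fun hbB => ?_, by omega, hfac _ _ hyu hWu,
          fun z hz => huB z (hyu.subset hz), Or.inr hy⟩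
        have := hy.length_le.trans (hM b hbB (n + 1))
        omega

lemma exists_att_of_hasLongBounded [Finite A] {τ : A → List A} {B : A → Prop} (hτ : Idem τ B)
    (hτ' : Idem (revS τ) B) {W : List A → Prop} (hfac : ∀ u v, u <:+: v → W v → W u) {K : ℕ}
    (hW : ∀ u, W u → ∃ s n, s.length ≤ K ∧ u <:+: iterW τ n s)
    (hlong : HasLongBounded B W) :
    ∃ c, RightAtt τ B c W ∨ RightAtt (revS τ) B c fun u => W u.reverse := by
  let P : A × Bool → ℕ → Prop := fun i N => ∃ k x, ¬ B i.1 ∧ N ≤ x.length ∧ W x ∧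
    (∀ y ∈ x, B y) ∧ if i.2 then x <:+ iterW τ k [i.1] else x <+: iterW τ k [i.1]
  have hP : ∀ N, ∃ i, P i N := by
    intro N
    obtain ⟨c, k, x, h1, h2, h3, h4, h5 | h5⟩ := hτ.exists_long_end hfac hW hlong N
    · exact ⟨(c, true), k, x, h1, h2, h3, h4, by simpa using h5⟩
    · exact ⟨(c, false), k, x, h1, h2, h3, h4, by simpa using h5⟩
  obtain ⟨⟨c, b⟩, hcb⟩ := exists_frequently_of_forall_exists hP
  have hc : ¬ B c := by
    obtain ⟨n, -, k, x, h, -⟩ := hcb 0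
    exact h
  cases b with
  | true =>
    obtain ⟨d, hd⟩ := hτ.exists_rightAtt hfac hc fun N => by
      obtain ⟨n, hn, k, x, -, h2, h3, h4, h5⟩ := hcb N
      exact ⟨k, x, hn.trans h2, h3, h4, by simpa using h5⟩
    exact ⟨d, Or.inl hd⟩
  | false =>
    obtain ⟨d, hd⟩ := hτ'.exists_rightAtt (W := fun u => W u.reverse)
      (fun u v huv hv => hfac _ _ (List.reverse_infix.2 huv) hv) hc fun N => by
        obtain ⟨n, hn, k, x, -, h2, h3, h4, h5⟩ := hcb N
        refine ⟨k, x.reverse, by simpa using hn.trans h2, by simpa using h3,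
          by simpa using h4, ?_⟩
        rw [iterW_revS_singleton, List.reverse_suffix]
        simpa using h5
    exact ⟨d, Or.inr hd⟩

/-- All iterated images of the letter `c` belong to `W`. -/
def MidAtt (τ : A → List A) (B : A → Prop) (c : A) (W : List A → Prop) : Prop :=
  ¬ B c ∧ ∀ i, W (iterW τ i [c])

lemma Idem.exists_midAtt [Finite A] {τ : A → List A} {B : A → Prop} (hτ : Idem τ B)
    {W : List A → Prop} (hfac : ∀ u v, u <:+: v → W v → W u) {K : ℕ}
    (hW : ∀ u, W u → ∃ s n, s.length ≤ K ∧ u <:+: iterW τ n s)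
    (hinf : ∀ N, ∃ u, N ≤ u.length ∧ W u)
    (hshort : ¬ HasLongBounded B W) : ∃ c, MidAtt τ B c W := by
  obtain ⟨g, hg⟩ : ∃ g, ∀ u, g ≤ u.length → W u → ∃ x ∈ u, ¬ B x := by
    simpa [HasLongBounded] using hshort
  have hP : ∀ k, ∃ d, ¬ B d ∧ W (iterW τ k [d]) := by
    intro k
    obtain ⟨M, hM⟩ := exists_length_le fun a => iterW τ k [a]
    obtain ⟨u, hul, hWu⟩ := hinf (2 * M + g + K * M + 1)
    obtain ⟨s, n, hs, hus⟩ := hW u hWu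
    obtain hnk | ⟨m, rfl⟩ : n ≤ k ∨ ∃ m, n = k + m := by
      rcases le_total n k with h | h
      · exact Or.inl h
      · exact Or.inr ⟨n - k, by omega⟩
    · have h1 := hus.length_le.trans (length_iterW_mono hτ.ne hnk s)
      rw [iterW_eq_flatMap] at h1
      have h2 := h1.trans (length_flatMap_le fun a _ => hM a)
      have h3 : s.length * M ≤ K * M := by gcongr
      omega
    · rw [iterW_add, iterW_eq_flatMap] at hus
      have hu0 : u ≠ [] := by rintro rfl; simp at hul
      rcases infix_flatMap hus hu0 with ⟨a, -, ha⟩ | ⟨a, t, b, x, y, hst, hu, hx, hy⟩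
      · have := ha.length_le.trans (hM a)
        omega
      · have hlen : u.length = x.length + (t.flatMap fun a => iterW τ k [a]).length
            + y.length := by rw [hu]; simp; omega
        have hxl := hx.length_le.trans (hM a)
        have hyl := hy.length_le.trans (hM b)
        have hWt : W (t.flatMap fun a => iterW τ k [a]) := hfac _ _ ⟨x, y, hu.symm⟩ hWu
        obtain ⟨z, hz, hzB⟩ := hg _ (by omega) hWt
        rw [← iterW_eq_flatMap] at hz hWt
        obtain ⟨d, hd, hzd⟩ := (mem_iterW τ k).1 hz
        refine ⟨d, fun hdB => hzB ?_, hfac _ _ (iterW_singleton_infix τ k hd) hWt⟩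
        exact hτ.mem_iterW_of_bounded k (by simpa using hdB) z hzd
  obtain ⟨d, hd⟩ := exists_frequently_of_forall_exists hP
  have hdB : ¬ B d := (hd 0).choose_spec.2.1
  obtain ⟨e, hed, heB⟩ := hτ.grow d hdB
  have hmem : ∀ j, ∀ e, ¬ B e → e ∈ τ d → e ∈ iterW τ (j + 1) [d] := by
    intro j
    induction j with
    | zero =>
      intro e _ he
      simpa [iterW_succ, iterW_zero, applyW] using he
    | succ j ih =>
      intro e heB he
      obtain ⟨c, hc, hec⟩ := List.mem_flatMap.1 (hτ.alph d e hdB heB he)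
      have hcB : ¬ B c := fun h => heB (hτ.closed c h e hec)
      rw [iterW_succ']
      exact List.mem_flatMap.2 ⟨c, ih c hcB hc, hec⟩
  refine ⟨e, heB, fun i => ?_⟩
  obtain ⟨k, hk, -, hWk⟩ := hd (i + 1)
  refine hfac _ _ ?_ hWk
  rw [show k = i + ((k - i - 1) + 1) by omega, iterW_add]
  exact iterW_singleton_infix τ i (hmem _ e heB hed)

lemma RightAtt.hasLongBounded_of_midAtt {τ : A → List A} {B : A → Prop} (hτ : Idem τ B)
    {W W' : List A → Prop} (hfac : ∀ u v, u <:+: v → W v → W u) {c : A}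
    (h : RightAtt τ B c W') (hm : MidAtt τ B c W) : HasLongBounded B W := by
  obtain ⟨-, v, u, hc, hu0, hu, -⟩ := h
  intro N
  obtain ⟨v', hv'⟩ := hτ.iterW_isolated hc hu N
  have hw : 1 ≤ (applyW τ u).length :=
    (List.length_pos_iff.2 hu0).trans_le (length_le_applyW hτ.ne u)
  refine ⟨(List.replicate N (applyW τ u)).flatten, ?_, ?_, fun x hx => ?_⟩
  · rw [length_flatten_replicate]
    exact Nat.le_mul_of_pos_right N hw
  · refine hfac _ _ ?_ (hm.2 (N + 1))
    rw [hv']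
    exact ⟨v' ++ c :: u, [], by simp⟩
  · obtain ⟨l, hl, hxl⟩ := List.mem_flatten.1 hx
    rw [List.eq_of_mem_replicate hl] at hxl
    exact hτ.mem_iterW_of_bounded 1 hu x hxl

lemma RightAtt.exists_long_common {τ : A → List A} {B : A → Prop} (hne : NonErasing τ)
    {W W' : List A → Prop} {c : A} (h : RightAtt τ B c W) (h' : RightAtt τ B c W') (N : ℕ) :
    ∃ u, N ≤ u.length ∧ W u ∧ W' u := by
  obtain ⟨hcB, v, u, hc, hu0, hu, hm⟩ := h
  obtain ⟨-, v', u', hc', -, hu', hm'⟩ := h'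
  obtain ⟨-, rfl⟩ := append_cons_inj_of_forall hcB hcB hu hu' (hc.symm.trans hc')
  refine ⟨_, ?_, hm N, hm' N⟩
  rw [length_flatten_replicate]
  exact Nat.le_mul_of_pos_right N
    ((List.length_pos_iff.2 hu0).trans_le (length_le_applyW hne u))

lemma MidAtt.exists_long_common {τ : A → List A} {B : A → Prop} (hτ : Idem τ B)
    {W W' : List A → Prop} {c : A} (h : MidAtt τ B c W) (h' : MidAtt τ B c W') (N : ℕ) :
    ∃ u, N ≤ u.length ∧ W u ∧ W' u := by
  obtain ⟨n, hn⟩ := hτ.unbdd c h.1 N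
  exact ⟨_, hn, h.2 n, h'.2 n⟩

end Language

section Subshift

/-- The word `u` occurs in an element of `X`. -/
def InLang (X : Set (ℤ → A)) (u : List A) : Prop := ∃ x ∈ X, OccursIn x u

lemma OccursIn.of_infix {x : ℤ → A} {u v : List A} (h : u <:+: v) (hv : OccursIn x v) :
    OccursIn x u := by
  obtain ⟨s, t, rfl⟩ := h
  obtain ⟨i, hi⟩ := hv
  refine ⟨i + s.length, fun j => ?_⟩
  have h1 : s.length + j.1 < (s ++ u ++ t).length := by simp; omega
  have h2 := hi ⟨s.length + j.1, h1⟩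
  simp only [Nat.cast_add, List.get_eq_getElem] at h2 ⊢
  rw [add_assoc, h2, List.getElem_append_left (by simp), List.getElem_append_right (by simp)]
  simp

lemma InLang.of_infix {X : Set (ℤ → A)} (u v : List A) (h : u <:+: v) (hv : InLang X v) :
    InLang X u := by
  obtain ⟨x, hx, hxv⟩ := hv
  exact ⟨x, hx, hxv.of_infix h⟩

lemma exists_long_inLang {X : Set (ℤ → A)} (hX : X.Nonempty) (N : ℕ) :
    ∃ u, N ≤ u.length ∧ InLang X u := by
  obtain ⟨x, hx⟩ := hX
  exact ⟨List.ofFn fun j : Fin N => x (0 + j.1), by simp, x, hx, 0, fun j => by simp⟩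

lemma shiftT_injective : Function.Injective (shiftT : (ℤ → A) → ℤ → A) := by
  intro x y h
  funext i
  simpa [shiftT] using congrFun h (i - 1)

variable [TopologicalSpace A]

lemma IsSubshift.shift_mem {X : Set (ℤ → A)} (hX : IsSubshift X) {x : ℤ → A} (hx : x ∈ X)
    (k : ℤ) : (fun i => x (i + k)) ∈ X := by
  induction k using Int.induction_on with
  | zero => simpa using hx
  | succ n ih =>
    rw [← hX.2.2]
    refine ⟨_, ih, ?_⟩
    funext i
    simp only [shiftT]
    congr 1
    ring
  | pred n ih =>
    rw [← hX.2.2] at ih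
    obtain ⟨y, hy, hyx⟩ := ih
    convert hy using 1
    funext i
    have := congrFun hyx (i - 1)
    simp only [shiftT, sub_add_cancel] at this
    rw [this]
    congr 1
    ring

lemma IsMinimalSubshift.eq_of_inter_nonempty {X Y : Set (ℤ → A)} (hX : IsMinimalSubshift X)
    (hY : IsMinimalSubshift Y) (h : (X ∩ Y).Nonempty) : X = Y := by
  have hs : IsSubshift (X ∩ Y) := ⟨h, hX.1.2.1.inter hY.1.2.1, by
    rw [Set.image_inter shiftT_injective, hX.1.2.2, hY.1.2.2]⟩
  exact (hX.2 _ Set.inter_subset_left hs).symm.trans (hY.2 _ Set.inter_subset_right hs)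

lemma IsMinimalSubshift.eq_of_long_common [Finite A] [DiscreteTopology A]
    {X Y : Set (ℤ → A)} (hX : IsMinimalSubshift X) (hY : IsMinimalSubshift Y)
    (h : ∀ N, ∃ u, N ≤ u.length ∧ InLang X u ∧ InLang Y u) : X = Y := by
  let t : ℕ → Set ((ℤ → A) × (ℤ → A)) := fun N =>
    (X ×ˢ Y) ∩ {p | ∀ i : ℤ, -N ≤ i → i ≤ N → p.1 i = p.2 i}
  have hXY : IsClosed (X ×ˢ Y) := hX.1.2.1.prod hY.1.2.1
  have hclosed : ∀ N, IsClosed (t N) := fun N => by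
    refine hXY.inter ?_
    simp only [Set.ofPred_forall]
    exact isClosed_iInter fun i => isClosed_iInter fun _ => isClosed_iInter fun _ =>
      isClosed_eq ((continuous_apply i).comp continuous_fst)
        ((continuous_apply i).comp continuous_snd)
  have hne : ∀ N, (t N).Nonempty := fun N => by
    obtain ⟨u, hu, ⟨x, hx, i, hi⟩, ⟨y, hy, j, hj⟩⟩ := h (2 * N + 1)
    refine ⟨(fun k => x (k + (i + N)), fun k => y (k + (j + N))),
      ⟨hX.1.shift_mem hx _, hY.1.shift_mem hy _⟩, fun k hk1 hk2 => ?_⟩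
    obtain ⟨m, hm⟩ := Int.eq_ofNat_of_zero_le (show 0 ≤ k + N by omega)
    have hmu : m < u.length := by omega
    have h1 := hi ⟨m, hmu⟩
    have h2 := hj ⟨m, hmu⟩
    simp only at h1 h2 ⊢
    rw [show k + (i + N) = i + m by omega, show k + (j + N) = j + m by omega, h1, h2]
  obtain ⟨p, hp⟩ := IsCompact.nonempty_iInter_of_sequence_nonempty_isCompact_isClosed t
    (fun N p hp => ⟨hp.1, fun i h1 h2 => hp.2 i (by push_cast; omega) (by push_cast; omega)⟩)
    hne (hclosed 0).isCompact hclosed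
  rw [Set.mem_iInter] at hp
  refine hX.eq_of_inter_nonempty hY ⟨p.1, (hp 0).1.1, ?_⟩
  have : p.1 = p.2 := by
    funext i
    exact (hp i.natAbs).2 i (by omega) (by omega)
  rw [this]
  exact (hp 0).1.2

end Subshift

/-- The ways in which the growing letter `c` can generate a language `W`: through its iterated
images, or through the bounded words on its right (`b = false`) or left (`b = true`). -/
def Generates (τ : A → List A) (B : A → Prop) (c : A) (b : Bool) (W : List A → Prop) : Prop :=
  (¬ HasLongBounded B W ∧ b = false ∧ MidAtt τ B c W) ∨
  (HasLongBounded B W ∧ b = false ∧ RightAtt τ B c W) ∨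
  (HasLongBounded B W ∧ b = true ∧ RightAtt (revS τ) B c fun u => W u.reverse)

lemma Generates.not_bounded {τ : A → List A} {B : A → Prop} {c : A} {b : Bool}
    {W : List A → Prop} (h : Generates τ B c b W) : ¬ B c := by
  rcases h with ⟨-, -, h⟩ | ⟨-, -, h⟩ | ⟨-, -, h⟩ <;> exact h.1

lemma HasLongBounded.reverse {B : A → Prop} {W : List A → Prop}
    (h : HasLongBounded B fun u => W u.reverse) : HasLongBounded B W := fun N => by
  obtain ⟨u, h1, h2, h3⟩ := h N
  exact ⟨u.reverse, by simpa using h1, h2, by simpa using h3⟩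

lemma MidAtt.reverse {τ : A → List A} {B : A → Prop} {c : A} {W : List A → Prop}
    (h : MidAtt τ B c W) : MidAtt (revS τ) B c fun u => W u.reverse :=
  ⟨h.1, fun i => by simpa [iterW_revS_singleton] using h.2 i⟩

lemma Generates.hasLongBounded_of_generates {τ : A → List A} {B : A → Prop} (hτ : Idem τ B)
    (hτ' : Idem (revS τ) B) {c : A} {b b' : Bool} {W W' : List A → Prop}
    (hfac : ∀ u v, u <:+: v → W v → W u) (h : Generates τ B c b W)
    (h' : Generates τ B c b' W') (hW' : HasLongBounded B W') : HasLongBounded B W := by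
  rcases h with ⟨h0, -, h⟩ | ⟨h0, -, -⟩ | ⟨h0, -, -⟩
  · rcases h' with ⟨h0', -, -⟩ | ⟨-, -, h'⟩ | ⟨-, -, h'⟩
    · exact absurd hW' h0'
    · exact h'.hasLongBounded_of_midAtt hτ hfac h
    · exact (h'.hasLongBounded_of_midAtt hτ'
        (fun u v huv hv => hfac _ _ (List.reverse_infix.2 huv) hv) h.reverse).reverse
  · exact h0
  · exact h0

lemma Generates.exists_long_common {τ : A → List A} {B : A → Prop} (hτ : Idem τ B)
    (hτ' : Idem (revS τ) B) {c : A} {b b' : Bool} {W W' : List A → Prop}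
    (h : Generates τ B c b W) (h' : Generates τ B c b' W')
    (hlong : HasLongBounded B W ↔ HasLongBounded B W')
    (hb : HasLongBounded B W → b = b') (N : ℕ) :
    ∃ u, N ≤ u.length ∧ W u ∧ W' u := by
  rcases h with ⟨h0, -, h⟩ | ⟨h0, h1, h⟩ | ⟨h0, h1, h⟩
  · rcases h' with ⟨-, -, h'⟩ | ⟨h0', -, -⟩ | ⟨h0', -, -⟩
    · exact h.exists_long_common hτ h' N
    · exact absurd (hlong.2 h0') h0
    · exact absurd (hlong.2 h0') h0
  · rcases h' with ⟨h0', -, -⟩ | ⟨-, -, h'⟩ | ⟨-, h1', -⟩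
    · exact absurd (hlong.1 h0) h0'
    · exact h.exists_long_common hτ.ne h' N
    · exact absurd (h1.symm.trans ((hb h0).trans h1')) (by simp)
  · rcases h' with ⟨h0', -, -⟩ | ⟨-, h1', -⟩ | ⟨-, -, h'⟩
    · exact absurd (hlong.1 h0) h0'
    · exact absurd (h1.symm.trans ((hb h0).trans h1')) (by simp)
    · obtain ⟨u, hu⟩ := h.exists_long_common hτ'.ne h' N
      exact ⟨u.reverse, by simpa using hu⟩

lemma exists_generates [Finite A] {τ : A → List A} {B : A → Prop} (hτ : Idem τ B)
    (hτ' : Idem (revS τ) B) {W : List A → Prop} (hfac : ∀ u v, u <:+: v → W v → W u) {K : ℕ}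
    (hW : ∀ u, W u → ∃ s n, s.length ≤ K ∧ u <:+: iterW τ n s)
    (hinf : ∀ N, ∃ u, N ≤ u.length ∧ W u) : ∃ p : A × Bool, Generates τ B p.1 p.2 W := by
  by_cases hlong : HasLongBounded B W
  · obtain ⟨c, h | h⟩ := exists_att_of_hasLongBounded hτ hτ' hfac hW hlong
    · exact ⟨(c, false), Or.inr (Or.inl ⟨hlong, rfl, h⟩)⟩
    · exact ⟨(c, true), Or.inr (Or.inr ⟨hlong, rfl, h⟩)⟩
  · obtain ⟨c, h⟩ := hτ.exists_midAtt hfac hW hinf hlong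
    exact ⟨(c, false), Or.inl ⟨hlong, rfl, h⟩⟩

lemma exists_short_ancestor [Finite A] {σ : A → List A} (hσ : NonErasing σ) {q : ℕ}
    (hq : 0 < q) : ∃ K, ∀ X ⊆ Xsub σ, ∀ u, InLang X u →
      ∃ s n, s.length ≤ K ∧ u <:+: iterW (powS σ q) n s := by
  obtain ⟨K, hK⟩ := exists_length_le fun a => iterW σ q [a]
  refine ⟨K, fun X hX u ⟨x, hx, hxu⟩ => ?_⟩
  obtain ⟨a, n, h⟩ := hX hx u hxu
  refine ⟨iterW σ (n % q) [a], n / q,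
    (length_iterW_mono hσ (Nat.mod_lt n hq).le [a]).trans (hK a), ?_⟩
  rwa [iterW_powS, ← iterW_add, Nat.div_add_mod]

/-- A code of each minimal component by a growing letter and a bit: components are determined
by their code, and the bit only matters for components with long bounded words. -/
lemma exists_code [Finite A] [hA : Nonempty A] [TopologicalSpace A] [DiscreteTopology A]
    {σ : A → List A} (hσ : NonErasing σ) :
    ∃ f : Set (ℤ → A) → A × Bool,
      (∀ X ∈ {X | X ⊆ Xsub σ ∧ IsMinimalSubshift X}, IsGrowing σ (f X).1) ∧
      ∀ X ∈ {X | X ⊆ Xsub σ ∧ IsMinimalSubshift X},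
      ∀ Y ∈ {X | X ⊆ Xsub σ ∧ IsMinimalSubshift X}, (f X).1 = (f Y).1 →
        (HasLongBounded (IsBounded σ) (InLang X) → HasLongBounded (IsBounded σ) (InLang Y) →
          (f X).2 = (f Y).2 ∨ X = Y) → X = Y := by
  obtain ⟨q, hq, hτ, hτ'⟩ := exists_idem_powS_both hσ
  obtain ⟨K, hK⟩ := exists_short_ancestor hσ hq
  have hex : ∀ X : Set (ℤ → A), ∃ p : A × Bool, X ⊆ Xsub σ ∧ IsMinimalSubshift X →
      Generates (powS σ q) (IsBounded σ) p.1 p.2 (InLang X) := by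
    intro X
    by_cases hX : X ⊆ Xsub σ ∧ IsMinimalSubshift X
    · obtain ⟨p, hp⟩ := exists_generates hτ hτ' InLang.of_infix (hK X hX.1)
        (exists_long_inLang hX.2.1.1)
      exact ⟨p, fun _ => hp⟩
    · obtain ⟨a⟩ := hA
      exact ⟨(a, true), fun h => absurd h hX⟩
  choose f hf using hex
  refine ⟨f, fun X hX => (hf X hX).not_bounded, fun X hX Y hY hXY hb => ?_⟩
  have h1 := hf X hX
  have h2 := hf Y hY
  rw [← hXY] at h2
  have hlong : HasLongBounded (IsBounded σ) (InLang X) ↔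
      HasLongBounded (IsBounded σ) (InLang Y) :=
    ⟨h2.hasLongBounded_of_generates hτ hτ' InLang.of_infix h1,
      h1.hasLongBounded_of_generates hτ hτ' InLang.of_infix h2⟩
  by_cases hne : X = Y
  · exact hne
  · refine hX.2.eq_of_long_common hY.2 (h1.exists_long_common hτ hτ' h2 hlong fun h => ?_)
    exact (hb h (hlong.1 h)).resolve_right hne

/-- Bounds on the number of minimal components of `X_σ` according to the number of
bounded letters. -/
theorem stmt15 [Fintype A] [TopologicalSpace A] [DiscreteTopology A]
    (σ : A → List A) (hσ : NonErasing σ) (hC : ∃ c, IsGrowing σ c) :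
    ((∀ a : A, ¬ IsBounded σ a) →
        {X : Set (ℤ → A) | X ⊆ Xsub σ ∧ IsMinimalSubshift X}.Finite ∧
        {X : Set (ℤ → A) | X ⊆ Xsub σ ∧ IsMinimalSubshift X}.ncard ≤ Fintype.card A) ∧
    ({a : A | IsBounded σ a}.ncard = 1 →
        {X : Set (ℤ → A) | X ⊆ Xsub σ ∧ IsMinimalSubshift X}.Finite ∧
        {X : Set (ℤ → A) | X ⊆ Xsub σ ∧ IsMinimalSubshift X}.ncard ≤ Fintype.card A - 1) ∧
    (2 ≤ {a : A | IsBounded σ a}.ncard →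
        {X : Set (ℤ → A) | X ⊆ Xsub σ ∧ IsMinimalSubshift X}.Finite ∧
        {X : Set (ℤ → A) | X ⊆ Xsub σ ∧ IsMinimalSubshift X}.ncard ≤
          2 * Fintype.card A - 4) := by
  obtain ⟨c₀, -⟩ := hC
  have : Nonempty A := ⟨c₀⟩
  obtain ⟨f, hgr, hinj⟩ := exists_code hσ
  set S := {X : Set (ℤ → A) | X ⊆ Xsub σ ∧ IsMinimalSubshift X} with hS
  have hcard : {a : A | IsBounded σ a}.ncard + {a : A | IsGrowing σ a}.ncard
      = Fintype.card A := by
    rw [← Nat.card_eq_fintype_card]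
    exact Set.ncard_add_ncard_compl {a : A | IsBounded σ a}
  have hfst : (∀ X ∈ S, ∀ Y ∈ S, HasLongBounded (IsBounded σ) (InLang X) →
      HasLongBounded (IsBounded σ) (InLang Y) → X = Y) →
      S.Finite ∧ S.ncard ≤ {a : A | IsGrowing σ a}.ncard := by
    intro h
    have hi : Set.InjOn (fun X => (f X).1) S := fun X hX Y hY hXY =>
      hinj X hX Y hY hXY fun h1 h2 => Or.inr (h X hX Y hY h1 h2)
    exact ⟨Set.Finite.of_injOn (t := {a : A | IsGrowing σ a}) hgr hi (Set.toFinite _),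
      Set.ncard_le_ncard_of_injOn _ hgr hi⟩
  refine ⟨fun hB => ?_, fun hB => ?_, fun hB => ?_⟩
  · obtain ⟨h1, h2⟩ := hfst fun X _ Y _ hX _ => by
      obtain ⟨u, hu, -, hu'⟩ := hX 1
      exact absurd (hu' _ (List.getElem_mem hu)) (hB _)
    exact ⟨h1, by omega⟩
  · obtain ⟨b, hb⟩ := Set.ncard_eq_one.1 hB
    have hrep : ∀ u : List A, (∀ x ∈ u, IsBounded σ x) → u = List.replicate u.length b :=
      fun u hu => List.eq_replicate_iff.2 ⟨rfl, fun x hx => by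
        have : x ∈ {a : A | IsBounded σ a} := hu x hx
        rwa [hb] at this⟩
    have hpre : ∀ {m n : ℕ}, m ≤ n → List.replicate m b <+: List.replicate n b :=
      fun {m n} h => ⟨List.replicate (n - m) b, by
        rw [List.replicate_append_replicate]; congr; omega⟩
    obtain ⟨h1, h2⟩ := hfst fun X hX Y hY hXl hYl =>
      hX.2.eq_of_long_common hY.2 fun N => by
        obtain ⟨u, hu, hXu, hu'⟩ := hXl N
        obtain ⟨v, hv, hYv, hv'⟩ := hYl N
        rw [hrep u hu'] at hXu
        rw [hrep v hv'] at hYv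
        refine ⟨List.replicate N b, by simp, InLang.of_infix _ _ ?_ hXu,
          InLang.of_infix _ _ ?_ hYv⟩
        · exact (hpre hu).isInfix
        · exact (hpre hv).isInfix
    exact ⟨h1, by omega⟩
  · have hi : Set.InjOn f S := fun X hX Y hY hXY =>
      hinj X hX Y hY (congrArg Prod.fst hXY) fun _ _ => Or.inl (congrArg Prod.snd hXY)
    have hmaps : ∀ X ∈ S, f X ∈ {a : A | IsGrowing σ a} ×ˢ (Set.univ : Set Bool) :=
      fun X hX => ⟨hgr X hX, trivial⟩
    have hle := Set.ncard_le_ncard_of_injOn f hmaps hi (Set.toFinite _)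
    rw [Set.ncard_prod, Set.ncard_univ, Nat.card_eq_fintype_card, Fintype.card_bool] at hle
    exact ⟨Set.Finite.of_injOn hmaps hi (Set.toFinite _), by omega⟩

end SubstPaper
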